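/- Let κ > 0 and let G be a probability measure on ℝ. For ε > 0 let μ_ε := cp(κε, G). Then for every w ∈ ℝ, lim_{ε→0⁺} ( μ_ε((−∞, w]) − 1_{[0,∞)}(w) ) / ε = κ·( G((−∞, w]) − 1_{[0,∞)}(w) ), where 1_{[0,∞)}(w) equals 1 if w ≥ 0 and 0 otherwise. -/

import Mathlib

open MeasureTheory Real Filter Topology

/-- `n`-fold convolution power of a measure on `ℝ` (`G^⋆0 = δ₀`). -/
noncomputable def convPow (G : Measure ℝ) : ℕ → Measure ℝ
  | 0 => Measure.dirac 0
  | n + 1 => (convPow G n).conv G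

/-- The compound Poisson distribution `cp(λ, G) = ∑ₙ e^{-λ} λⁿ/n! • G^⋆n`. -/
noncomputable def cp (lam : ℝ) (G : Measure ℝ) : Measure ℝ :=
  Measure.sum fun n => (ENNReal.ofReal (exp (-lam) * lam ^ n / n.factorial)) • convPow G n

/-- An exponential generating function with coefficients in `[0, 1]` has derivative `a 1` at `0`. -/
theorem hasDerivAt_tsum_pow_div_factorial {a : ℕ → ℝ} (h0 : ∀ n, 0 ≤ a n) (h1 : ∀ n, a n ≤ 1) :
    HasDerivAt (fun t : ℝ => ∑' n, t ^ n / n.factorial * a n) (a 1) 0 := by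
  have hs : ∀ t : ℝ, Summable fun n : ℕ => t ^ n / n.factorial * a n := fun t => by
    refine Summable.of_norm_bounded (Real.summable_pow_div_factorial |t|) fun n => ?_
    rw [norm_mul, norm_div, norm_pow, Real.norm_eq_abs, Real.norm_natCast, Real.norm_eq_abs,
      abs_of_nonneg (h0 n)]
    exact mul_le_of_le_one_right (by positivity) (h1 n)
  have key : ∀ t : ℝ, (∑' n, t ^ n / n.factorial * a n) =
      a 0 + t * a 1 + t ^ 2 * ∑' n : ℕ, t ^ n / (n + 2).factorial * a (n + 2) := fun t => by
    rw [← (hs t).sum_add_tsum_nat_add 2, ← tsum_mul_left]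
    simp only [Finset.sum_range_succ, Finset.sum_range_zero]
    congr 1
    · simp
    · exact tsum_congr fun n => by ring
  have hR : ∀ t : ℝ, ‖∑' n : ℕ, t ^ n / (n + 2).factorial * a (n + 2)‖ ≤ Real.exp |t| :=
    fun t => by
    rw [Real.exp_eq_exp_ℝ, NormedSpace.exp_eq_tsum_div]
    refine tsum_of_norm_bounded (Real.summable_pow_div_factorial |t|).hasSum fun n => ?_
    rw [norm_mul, norm_div, norm_pow, Real.norm_eq_abs, Real.norm_natCast, Real.norm_eq_abs,
      abs_of_nonneg (h0 _)]
    refine (mul_le_of_le_one_right (by positivity) (h1 _)).trans ?_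
    gcongr
    omega
  rw [hasDerivAt_iff_tendsto_slope]
  have hlim : Tendsto (fun t : ℝ => t * ∑' n : ℕ, t ^ n / (n + 2).factorial * a (n + 2))
      (𝓝[≠] 0) (𝓝 0) := by
    refine tendsto_nhdsWithin_of_tendsto_nhds (squeeze_zero_norm
      (a := fun t : ℝ => |t| * Real.exp |t|) (fun t => ?_) ?_)
    · rw [norm_mul, Real.norm_eq_abs]
      exact mul_le_mul_of_nonneg_left (hR t) (abs_nonneg t)
    · have hc : Continuous fun t : ℝ => |t| * Real.exp |t| := by fun_prop
      simpa using hc.tendsto 0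
  have hlim' := hlim.const_add (a 1)
  rw [add_zero] at hlim'
  refine hlim'.congr' ?_
  filter_upwards [self_mem_nhdsWithin] with t ht
  have ht' : t ≠ 0 := ht
  rw [slope_def_field, key t, key 0]
  field_simp
  ring

instance isProbabilityMeasure_convPow (G : Measure ℝ) [IsProbabilityMeasure G] (n : ℕ) :
    IsProbabilityMeasure (convPow G n) := by
  induction n with
  | zero => exact inferInstanceAs (IsProbabilityMeasure (Measure.dirac 0))
  | succ n ih => exact inferInstanceAs (IsProbabilityMeasure ((convPow G n).conv G))

theorem cp_real_apply {t : ℝ} (ht : 0 ≤ t) (G : Measure ℝ) [IsProbabilityMeasure G] {s : Set ℝ}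
    (hs : MeasurableSet s) :
    (cp t G s).toReal =
      exp (-t) * ∑' n : ℕ, t ^ n / n.factorial * (convPow G n s).toReal := by
  rw [cp, Measure.sum_apply _ hs, ENNReal.tsum_toReal_eq, ← tsum_mul_left]
  · refine tsum_congr fun n => ?_
    rw [Measure.smul_apply, smul_eq_mul, ENNReal.toReal_mul,
      ENNReal.toReal_ofReal (by positivity)]
    ring
  · intro n
    rw [Measure.smul_apply, smul_eq_mul]
    exact ENNReal.mul_ne_top ENNReal.ofReal_ne_top (measure_ne_top _ _)

/-- short-time derivative of the compound Poisson CDF: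
`(μ_ε(-∞, w] - 1_{[0,∞)}(w)) / ε → κ (G(-∞, w] - 1_{[0,∞)}(w))` as `ε → 0⁺`,
where `μ_ε = cp(κε, G)`. -/
theorem stmt_9 (κ : ℝ) (hκ : 0 < κ) (G : Measure ℝ) [IsProbabilityMeasure G] (w : ℝ) :
    Tendsto
      (fun ε => (((cp (κ * ε) G) (Set.Iic w)).toReal - (if 0 ≤ w then (1:ℝ) else 0)) / ε)
      (𝓝[>] (0:ℝ))
      (𝓝 (κ * ((G (Set.Iic w)).toReal - if 0 ≤ w then (1:ℝ) else 0))) := by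
  set a : ℕ → ℝ := fun n => (convPow G n (Set.Iic w)).toReal with ha
  have ha0 : a 0 = if 0 ≤ w then (1:ℝ) else 0 := by
    simp only [ha, convPow, Measure.dirac_apply' _ measurableSet_Iic, Set.indicator_apply,
      Set.mem_Iic, Pi.one_apply]
    split_ifs <;> simp
  have ha1 : a 1 = (G (Set.Iic w)).toReal := by
    simp only [ha, convPow, Measure.dirac_zero_conv]
  rw [← ha0, ← ha1]
  have hH := hasDerivAt_tsum_pow_div_factorial (a := a) (fun n => ENNReal.toReal_nonneg)
    fun n => measureReal_le_one
  have hF : HasDerivAt (fun t : ℝ => exp (-t) * ∑' n : ℕ, t ^ n / n.factorial * a n)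
      (a 1 - a 0) 0 := by
    have hsum : (∑' n : ℕ, (0:ℝ) ^ n / n.factorial * a n) = a 0 := by
      rw [tsum_eq_single 0 fun n hn => by simp [hn]]
      simp
    refine ((hasDerivAt_neg (0:ℝ)).exp.mul hH).congr_deriv ?_
    rw [hsum, neg_zero, exp_zero]
    ring
  have hF' : HasDerivAt (fun ε : ℝ => exp (-(κ * ε)) * ∑' n : ℕ, (κ * ε) ^ n / n.factorial * a n)
      (κ * (a 1 - a 0)) 0 := by
    have hκε : HasDerivAt (fun ε : ℝ => κ * ε) κ 0 := by
      simpa using (hasDerivAt_id (0:ℝ)).const_mul κ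
    rw [mul_comm κ]
    exact HasDerivAt.comp (h₂ := fun t : ℝ => exp (-t) * ∑' n : ℕ, t ^ n / n.factorial * a n)
      0 (by simpa using hF) hκε
  have hslope := (hasDerivAt_iff_tendsto_slope.1 hF').mono_left
    (nhdsWithin_mono 0 fun ε (hε : 0 < ε) => hε.ne')
  refine hslope.congr' ?_
  filter_upwards [self_mem_nhdsWithin] with ε hε
  rw [slope_def_field, cp_real_apply (mul_nonneg hκ.le (le_of_lt hε)) G measurableSet_Iic]
  have hsum : (∑' n : ℕ, (κ * 0) ^ n / n.factorial * a n) = a 0 := by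
    rw [tsum_eq_single 0 fun n hn => by simp [hn]]
    simp
  rw [hsum, mul_zero, neg_zero, exp_zero, one_mul, sub_zero]
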